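/- Let P be a set of prime numbers, let λ : ℕ → ℚ be a completely multiplicative arithmetic function (λ(1) = 1 and λ(mn) = λ(m)λ(n) for all m, n) whose support {n : λ(n) ≠ 0} equals S(P), let t₀ be a rational number such that t₀·(n−1) is an integer for all n ∈ S(P), let R be a finite set of positive integers, and let {t_r}_{r∈R} be integers. Define f_n(q) = λ(n) · q^{t₀(n−1)} · ∏_{r∈R} [n]_{q^r}^{t_r} in RatFunc ℚ for n ∈ S(P), and f_n(q) = 0 for n ∉ S(P). Then the sequence F = {f_n(q)}_{n=1}^∞ satisfies the functional equation for multiplication of quantum integers and supp(F) = S(P). -/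

import Mathlib

open scoped Classical

open Polynomial

/-- `S(P)`: the multiplicative semigroup of positive integers generated by the
set `P` of primes, i.e. the positive integers all of whose prime factors lie in `P`. -/
def SP (P : Set ℕ) : Set ℕ :=
  {n : ℕ | 0 < n ∧ ∀ p : ℕ, p.Prime → p ∣ n → p ∈ P}

/-- Substitution of `q^m` for the variable `q` in a rational function `f ∈ RatFunc ℚ`:
`f(q^m) = num(q^m) / denom(q^m)`. -/
noncomputable def qSubst (m : ℕ) (f : RatFunc ℚ) : RatFunc ℚ :=
  (f.num.eval₂ RatFunc.C (RatFunc.X ^ m)) / (f.denom.eval₂ RatFunc.C (RatFunc.X ^ m))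

/-- A sequence of rational functions satisfies the functional equation for
multiplication of quantum integers if `f_{mn}(q) = f_m(q) · f_n(q^m)` for all
positive integers `m` and `n`. -/
def SatisfiesFE (f : ℕ → RatFunc ℚ) : Prop :=
  ∀ m n : ℕ, 0 < m → 0 < n → f (m * n) = f m * qSubst m (f n)

/-- The quantum integer `[n]_{q^r} = 1 + q^r + q^{2r} + ⋯ + q^{(n-1)r}`, regarded
as an element of `RatFunc ℚ`. -/
noncomputable def qInt (n r : ℕ) : RatFunc ℚ :=
  algebraMap (Polynomial ℚ) (RatFunc ℚ) (∑ i ∈ Finset.range n, (X ^ r) ^ i)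

/-- Substitution of `q^m` for `q` on polynomials, with values in the rational functions,
is expansion by `m`. -/
theorem eval₂_C_X_pow (m : ℕ) (p : ℚ[X]) :
    p.eval₂ RatFunc.C (RatFunc.X ^ m) =
      algebraMap ℚ[X] (RatFunc ℚ) (Polynomial.expand ℚ m p) := by
  induction p using Polynomial.induction_on' with
  | add p q hp hq => simp [eval₂_add, hp, hq]
  | monomial n a =>
    rw [Polynomial.expand_monomial, eval₂_monomial, ← C_mul_X_pow_eq_monomial]
    simp [pow_mul']

theorem eval₂_C_X_pow_injective {m : ℕ} (hm : 0 < m) :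
    Function.Injective (eval₂RingHom (RatFunc.C (K := ℚ)) (RatFunc.X ^ m)) := by
  intro p q h
  simp only [coe_eval₂RingHom, eval₂_C_X_pow] at h
  exact expand_injective hm (RatFunc.algebraMap_injective ℚ h)

/-- Substitution of `q^m` for `q`, with `m` positive, as a ring endomorphism of the rational
functions. -/
noncomputable def qSubstHom (m : ℕ) (hm : 0 < m) : RatFunc ℚ →+* RatFunc ℚ :=
  RatFunc.liftRingHom (eval₂RingHom RatFunc.C (RatFunc.X ^ m))
    (nonZeroDivisors_le_comap_nonZeroDivisors_of_injective _ (eval₂_C_X_pow_injective hm))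

theorem qSubst_eq_qSubstHom {m : ℕ} (hm : 0 < m) (f : RatFunc ℚ) :
    qSubst m f = qSubstHom m hm f := by
  rw [qSubstHom, RatFunc.liftRingHom_apply]
  rfl

theorem qSubstHom_algebraMap {m : ℕ} (hm : 0 < m) (p : ℚ[X]) :
    qSubstHom m hm (algebraMap ℚ[X] (RatFunc ℚ) p) =
      algebraMap ℚ[X] (RatFunc ℚ) (Polynomial.expand ℚ m p) := by
  rw [← eval₂_C_X_pow, qSubstHom, RatFunc.liftRingHom_algebraMap]
  rfl

theorem qSubstHom_C {m : ℕ} (hm : 0 < m) (a : ℚ) :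
    qSubstHom m hm (RatFunc.C a) = RatFunc.C a := by
  rw [← RatFunc.algebraMap_C, qSubstHom_algebraMap, expand_C]

theorem qSubstHom_X {m : ℕ} (hm : 0 < m) :
    qSubstHom m hm RatFunc.X = RatFunc.X ^ m := by
  rw [← RatFunc.algebraMap_X, qSubstHom_algebraMap, expand_X, map_pow]

theorem qInt_mul {m r : ℕ} (hm : 0 < m) (hr : 0 < r) (n : ℕ) :
    qInt (m * n) r = qInt m r * qSubstHom m hm (qInt n r) := by
  simp only [qInt, qSubstHom_algebraMap, ← map_mul]
  congr 1
  have hX : (X ^ r - 1 : ℚ[X]) ≠ 0 := X_pow_sub_C_ne_zero hr 1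
  have hexp : Polynomial.expand ℚ m (∑ i ∈ Finset.range n, (X ^ r) ^ i) =
      ∑ i ∈ Finset.range n, ((X ^ r) ^ m) ^ i := by
    simp only [map_sum, map_pow, expand_X]
    simp only [← pow_mul, mul_comm m r]
  apply mul_right_cancel₀ hX
  rw [hexp, geom_sum_mul, mul_right_comm, geom_sum_mul, mul_geom_sum, pow_mul]

theorem qInt_ne_zero {n : ℕ} (hn : 0 < n) (r : ℕ) : qInt n r ≠ 0 := by
  rw [qInt, Ne, map_eq_zero_iff _ (RatFunc.algebraMap_injective ℚ)]
  intro h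
  have := congrArg (Polynomial.eval 1) h
  simp [eval_finsetSum] at this
  omega

theorem mul_mem_SP_iff {P : Set ℕ} {m n : ℕ} (hm : 0 < m) (hn : 0 < n) :
    m * n ∈ SP P ↔ m ∈ SP P ∧ n ∈ SP P := by
  constructor
  · rintro ⟨-, h⟩
    exact ⟨⟨hm, fun p hp hd => h p hp (hd.mul_right n)⟩,
      ⟨hn, fun p hp hd => h p hp (hd.mul_left m)⟩⟩
  · rintro ⟨⟨-, h₁⟩, ⟨-, h₂⟩⟩
    exact ⟨Nat.mul_pos hm hn, fun p hp hd => (hp.dvd_mul.1 hd).elim (h₁ p hp) (h₂ p hp)⟩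

/-- Let `P` be a set of primes, `λ` a completely multiplicative arithmetic function
with support `S(P)`, `t₀` a rational number with `t₀(n−1) ∈ ℤ` for all `n ∈ S(P)`
(the integer exponents being recorded by `e : ℕ → ℤ`), `R` a finite set of positive
integers and `{t_r}` integers.  Then the sequence defined by
`f_n(q) = λ(n) · q^{t₀(n−1)} · ∏_{r ∈ R} [n]_{q^r}^{t_r}` for `n ∈ S(P)` and
`f_n(q) = 0` otherwise satisfies the functional equation for multiplication of
quantum integers, and `supp(F) = S(P)`. -/
theorem construction_satisfies_fe (P : Set ℕ) (hP : ∀ p ∈ P, p.Prime)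
    (lam : ℕ → ℚ) (hlam1 : lam 1 = 1)
    (hlam : ∀ m n : ℕ, 0 < m → 0 < n → lam (m * n) = lam m * lam n)
    (hlamsupp : ∀ n : ℕ, 0 < n → (lam n ≠ 0 ↔ n ∈ SP P))
    (t₀ : ℚ) (e : ℕ → ℤ) (he : ∀ n ∈ SP P, (e n : ℚ) = t₀ * ((n : ℚ) - 1))
    (R : Finset ℕ) (hR : ∀ r ∈ R, 0 < r) (t : ℕ → ℤ)
    (f : ℕ → RatFunc ℚ)
    (hfdef : ∀ n : ℕ, f n = if n ∈ SP P then
        RatFunc.C (lam n) * RatFunc.X ^ (e n) * ∏ r ∈ R, (qInt n r) ^ (t r)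
      else 0) :
    SatisfiesFE f ∧ ∀ n : ℕ, 0 < n → (f n ≠ 0 ↔ n ∈ SP P) := by
  refine ⟨fun m n hm hn => ?_, fun n hn => ?_⟩
  · rw [qSubst_eq_qSubstHom hm, hfdef (m * n), hfdef m, hfdef n]
    by_cases hmS : m ∈ SP P
    · by_cases hnS : n ∈ SP P
      · have hmnS := (mul_mem_SP_iff hm hn).2 ⟨hmS, hnS⟩
        have hexp : e (m * n) = e m + m * e n := by
          have h : (e (m * n) : ℚ) = e m + m * e n := by
            rw [he _ hmnS, he m hmS, he n hnS]
            push_cast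
            ring
          exact_mod_cast h
        have hprod : ∏ r ∈ R, qInt (m * n) r ^ t r =
            (∏ r ∈ R, qInt m r ^ t r) * ∏ r ∈ R, qSubstHom m hm (qInt n r) ^ t r := by
          rw [← Finset.prod_mul_distrib]
          exact Finset.prod_congr rfl fun r hr => by rw [qInt_mul hm (hR r hr), mul_zpow]
        rw [if_pos hmnS, if_pos hmS, if_pos hnS, hprod, hlam m n hm hn, hexp,
          zpow_add₀ RatFunc.X_ne_zero, zpow_mul, zpow_natCast]
        simp only [map_mul, map_prod, map_zpow₀, qSubstHom_C, qSubstHom_X]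
        ring
      · rw [if_neg fun h => hnS ((mul_mem_SP_iff hm hn).1 h).2, if_neg hnS, map_zero, mul_zero]
    · rw [if_neg fun h => hmS ((mul_mem_SP_iff hm hn).1 h).1, if_neg hmS, zero_mul]
  · rw [hfdef n]
    by_cases hnS : n ∈ SP P
    · rw [if_pos hnS]
      refine iff_of_true (mul_ne_zero (mul_ne_zero ?_ (zpow_ne_zero _ RatFunc.X_ne_zero)) ?_) hnS
      · exact (_root_.map_ne_zero RatFunc.C).2 ((hlamsupp n hn).2 hnS)
      · exact Finset.prod_ne_zero_iff.2 fun r _ => zpow_ne_zero _ (qInt_ne_zero hn r)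
    · simp [hnS]
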